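/- Let V : ℝⁿ → ℝ ∪ {+∞} be a convex lower semicontinuous function such that Z := ∫ e^{-V(x)} dx ∈ (0,∞), let η be the probability measure with density Z⁻¹ e^{-V}, and let ν = (∇V)#η be its moment measure. Then 𝒯(ν, η) = ∫ V* dν + ∫ V dη = ∫ x·∇V(x) dη(x). -/

import Mathlib

open MeasureTheory Real Set
open scoped ENNReal InnerProductSpace

noncomputable section

variable {E : Type*} [NormedAddCommGroup E] [InnerProductSpace ℝ E]

/-- `exp (-t)` for an extended-real `t`, with the convention that it is `0` at `⊤`
(proper functions never take the value `⊥`; we also set the value at `⊥` to `0`). -/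
def expNeg (t : EReal) : ℝ := if t = ⊤ then 0 else if t = ⊥ then 0 else Real.exp (-t.toReal)

/-- Convexity for extended-real-valued functions. -/
def ConvexEReal (f : E → EReal) : Prop :=
  ∀ x y : E, ∀ a b : ℝ, 0 ≤ a → 0 ≤ b → a + b = 1 →
    f (a • x + b • y) ≤ (a : EReal) * f x + (b : EReal) * f y

/-- The class `𝓕` of proper convex lower semicontinuous functions `E → ℝ ∪ {+∞}`. -/
def IsProperConvexLSC (f : E → EReal) : Prop :=
  ConvexEReal f ∧ LowerSemicontinuous f ∧ (∀ x, f x ≠ ⊥) ∧ (∃ x, f x ≠ ⊤)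

/-- Fenchel-Legendre transform of an extended-real-valued function. -/
def fenchel (f : E → EReal) (y : E) : EReal := ⨆ x : E, (⟪x, y⟫_ℝ : EReal) - f x

/-- positive part of an extended real, as `ℝ≥0∞`. -/
def ERealPos (t : EReal) : ℝ≥0∞ := if t = ⊤ then ⊤ else ENNReal.ofReal t.toReal

/-- Integral of an extended-real-valued function, with value in `EReal`. -/
def eintegral {α : Type*} [MeasurableSpace α] (μ : Measure α) (g : α → EReal) : EReal :=
  ((∫⁻ x, ERealPos (g x) ∂μ : ℝ≥0∞) : EReal) - ((∫⁻ x, ERealPos (-(g x)) ∂μ : ℝ≥0∞) : EReal)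

/-- An extended-real-valued function belongs to `L¹(μ)` : it is `μ`-a.e. finite and its
real part is integrable. -/
def MemL1 {α : Type*} [MeasurableSpace α] (μ : Measure α) (g : α → EReal) : Prop :=
  (∀ᵐ x ∂μ, g x ≠ ⊤ ∧ g x ≠ ⊥) ∧ Integrable (fun x => (g x).toReal) μ

variable [MeasurableSpace E]

/-- The maximal correlation transport cost `𝒯(μ₁, μ₂)`. -/
def mcCost (μ₁ μ₂ : Measure E) : EReal :=
  ⨅ f : {f : E → EReal // IsProperConvexLSC f},
    eintegral μ₁ f.1 + eintegral μ₂ (fenchel f.1)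

/-- Relative entropy with respect to the Lebesgue measure. -/
def relEnt {n : ℕ} (μ : Measure (EuclideanSpace ℝ (Fin n))) : ℝ :=
  ∫ x, Real.log ((μ.rnDeriv volume x).toReal) ∂μ

section ExtendedReal

lemma expNeg_nonneg (t : EReal) : 0 ≤ expNeg t := by
  unfold expNeg
  split_ifs <;> positivity

@[simp] lemma expNeg_top : expNeg ⊤ = 0 := by simp [expNeg]

@[simp] lemma expNeg_coe (r : ℝ) : expNeg (r : EReal) = Real.exp (-r) := by simp [expNeg]

lemma expNeg_le_exp {t : EReal} {r : ℝ} (h : (r : EReal) ≤ t) : expNeg t ≤ Real.exp (-r) := by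
  induction t with
  | bot => simp at h
  | top => simpa using (Real.exp_pos _).le
  | coe s => simpa using h

lemma exp_le_expNeg {t : EReal} {r : ℝ} (h' : t ≠ ⊥) (h : t ≤ r) :
    Real.exp (-r) ≤ expNeg t := by
  induction t with
  | bot => simp at h'
  | top => simp at h
  | coe s => simpa using h

lemma measurable_expNeg : Measurable expNeg := by
  unfold expNeg
  refine Measurable.ite (measurableSet_singleton _) measurable_const
    (Measurable.ite (measurableSet_singleton _) measurable_const ?_)
  exact Real.measurable_exp.comp (measurable_ereal_toReal.neg)

lemma ERealPos_eq_toENNReal (t : EReal) : ERealPos t = t.toENNReal := rfl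

lemma ERealPos_mono {s t : EReal} (h : s ≤ t) : ERealPos s ≤ ERealPos t :=
  EReal.toENNReal_le_toENNReal h

lemma ERealPos_add_neg_add_neg (s t : EReal) (hs : s ≠ ⊥) (ht : t ≠ ⊥) :
    ERealPos (s + t) + (ERealPos (-s) + ERealPos (-t)) =
      ERealPos (-(s + t)) + (ERealPos s + ERealPos t) := by
  induction s with
  | bot => simp at hs
  | top => simp [ERealPos, EReal.top_add_of_ne_bot ht]
  | coe a =>
    induction t with
    | bot => simp at ht
    | top => simp [ERealPos]
    | coe b =>
      simp only [ERealPos_eq_toENNReal, ← EReal.coe_add, ← EReal.coe_neg,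
        EReal.real_coe_toENNReal]
      rw [← ENNReal.toReal_eq_toReal_iff' (by finiteness) (by finiteness)]
      simp only [ENNReal.toReal_add, ENNReal.ofReal_ne_top, ENNReal.toReal_ofReal', ne_eq,
        not_false_eq_true, ENNReal.add_eq_top, or_self]
      have h (x : ℝ) : max x 0 = max (-x) 0 + x := by
        rcases le_total x 0 with hx | hx <;> simp [hx]
      rw [h (a + b), h a, h b]
      ring

end ExtendedReal

section ExtendedIntegral

variable {α : Type*} [MeasurableSpace α] {μ : Measure α}

lemma measurable_ERealPos_comp {g : α → EReal} (hg : Measurable g) :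
    Measurable fun x => ERealPos (g x) :=
  hg.ereal_toENNReal

lemma measurable_ERealPos_neg {g : α → EReal} (hg : Measurable g) :
    Measurable fun x => ERealPos (-(g x)) :=
  measurable_ERealPos_comp (continuous_neg.measurable.comp hg)

lemma eintegral_mono_ae {g h : α → EReal} (hgh : ∀ᵐ x ∂μ, g x ≤ h x) :
    eintegral μ g ≤ eintegral μ h := by
  refine EReal.sub_le_sub ?_ ?_ <;> rw [EReal.coe_ennreal_le_coe_ennreal_iff]
  · exact lintegral_mono_ae (hgh.mono fun x hx => ERealPos_mono hx)
  · exact lintegral_mono_ae (hgh.mono fun x hx => ERealPos_mono (EReal.neg_le_neg_iff.2 hx))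

lemma eintegral_congr_ae {g h : α → EReal} (hgh : g =ᵐ[μ] h) :
    eintegral μ g = eintegral μ h :=
  le_antisymm (eintegral_mono_ae hgh.le) (eintegral_mono_ae hgh.symm.le)

lemma eintegral_map {β : Type*} [MeasurableSpace β] {T : α → β} (hT : Measurable T)
    {g : β → EReal} (hg : Measurable g) :
    eintegral (Measure.map T μ) g = eintegral μ (fun x => g (T x)) := by
  unfold eintegral
  rw [lintegral_map (measurable_ERealPos_comp hg) hT,
    lintegral_map (measurable_ERealPos_neg hg) hT]

lemma ae_ne_bot_of_lintegral_neg_ne_top {g : α → EReal} (hg : Measurable g)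
    (h : ∫⁻ x, ERealPos (-(g x)) ∂μ ≠ ⊤) : ∀ᵐ x ∂μ, g x ≠ ⊥ := by
  filter_upwards [ae_lt_top (measurable_ERealPos_neg hg) h]
    with x hx hbot
  simp [ERealPos, hbot] at hx

lemma eintegral_add {g h : α → EReal} (hg : Measurable g) (hh : Measurable h)
    (hg' : ∫⁻ x, ERealPos (-(g x)) ∂μ ≠ ⊤) (hh' : ∫⁻ x, ERealPos (-(h x)) ∂μ ≠ ⊤) :
    eintegral μ (fun x => g x + h x) = eintegral μ g + eintegral μ h := by
  have mg := measurable_ERealPos_comp hg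
  have mh := measurable_ERealPos_comp hh
  have mg' := measurable_ERealPos_neg hg
  have mh' := measurable_ERealPos_neg hh
  have hgh : Measurable fun x => g x + h x := hg.add hh
  have ms := measurable_ERealPos_comp hgh
  have ms' := measurable_ERealPos_neg hgh
  have bg := ae_ne_bot_of_lintegral_neg_ne_top hg hg'
  have bh := ae_ne_bot_of_lintegral_neg_ne_top hh hh'
  have key : ∫⁻ x, ERealPos (g x + h x) ∂μ +
        (∫⁻ x, ERealPos (-(g x)) ∂μ + ∫⁻ x, ERealPos (-(h x)) ∂μ) =
      ∫⁻ x, ERealPos (-(g x + h x)) ∂μ +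
        (∫⁻ x, ERealPos (g x) ∂μ + ∫⁻ x, ERealPos (h x) ∂μ) := by
    rw [← lintegral_add_left mg', ← lintegral_add_left mg, ← lintegral_add_left ms,
      ← lintegral_add_left ms']
    refine lintegral_congr_ae ?_
    filter_upwards [bg, bh] with x h1 h2
    exact ERealPos_add_neg_add_neg _ _ h1 h2
  have hs' : ∫⁻ x, ERealPos (-(g x + h x)) ∂μ ≠ ⊤ := by
    refine ne_top_of_le_ne_top (ENNReal.add_ne_top.2 ⟨hg', hh'⟩) ?_
    rw [← lintegral_add_left mg']
    refine lintegral_mono_ae ?_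
    filter_upwards [bg, bh] with x h1 h2
    rw [EReal.neg_add (Or.inl h1) (Or.inr h2), sub_eq_add_neg]
    exact EReal.toENNReal_add_le
  unfold eintegral
  generalize ∫⁻ x, ERealPos (g x + h x) ∂μ = a at *
  generalize ∫⁻ x, ERealPos (-(g x)) ∂μ = b at *
  generalize ∫⁻ x, ERealPos (-(h x)) ∂μ = c at *
  generalize ∫⁻ x, ERealPos (-(g x + h x)) ∂μ = d at *
  generalize ∫⁻ x, ERealPos (g x) ∂μ = e at *
  generalize ∫⁻ x, ERealPos (h x) ∂μ = f at *
  lift b to NNReal using hg'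
  lift c to NNReal using hh'
  lift d to NNReal using hs'
  induction a with
  | top =>
    have : e = ⊤ ∨ f = ⊤ := by simpa using key.symm
    rcases this with rfl | rfl
    · induction f <;> rfl
    · induction e <;> rfl
  | coe a =>
    induction e with
    | top => simp at key
    | coe e =>
      induction f with
      | top => simp at key
      | coe f =>
        have key' : (a : ℝ) + (b + c) = d + (e + f) := by exact_mod_cast key
        change ((a : ℝ) : EReal) - ((d : ℝ) : EReal) =
          ((e : ℝ) : EReal) - ((b : ℝ) : EReal) + (((f : ℝ) : EReal) - ((c : ℝ) : EReal))
        norm_cast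
        linarith

end ExtendedIntegral

section Convex

variable {F : Type*} [NormedAddCommGroup F] [InnerProductSpace ℝ F]

lemma ConvexEReal.le_coe {f : F → EReal} (hf : ConvexEReal f) {x y : F} {p q a b : ℝ}
    (hx : f x ≤ p) (hy : f y ≤ q) (ha : 0 ≤ a) (hb : 0 ≤ b) (hab : a + b = 1) :
    f (a • x + b • y) ≤ ((a * p + b * q : ℝ) : EReal) := by
  refine (hf x y a b ha hb hab).trans ?_
  rw [EReal.coe_add, EReal.coe_mul, EReal.coe_mul]
  exact add_le_add (mul_le_mul_of_nonneg_left hx (EReal.coe_nonneg.2 ha))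
    (mul_le_mul_of_nonneg_left hy (EReal.coe_nonneg.2 hb))

lemma ConvexEReal.convex_sublevel {f : F → EReal} (hf : ConvexEReal f) (M : ℝ) :
    Convex ℝ {x | f x ≤ M} := by
  intro x hx y hy a b ha hb hab
  have := hf.le_coe hx hy ha hb hab
  rwa [← add_mul, hab, one_mul] at this

lemma ConvexEReal.le_half_of_mem_ball (hf : ConvexEReal f) {c x z : F} {r M L : ℝ}
    (hM : ∀ y ∈ Metric.ball c r, f y ≤ M) (hx : f x ≤ L)
    (hz : z ∈ Metric.ball ((2⁻¹ : ℝ) • (x + c)) (r / 2)) : f z ≤ (((L + M) / 2 : ℝ) : EReal) := by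
  have hy : (2 : ℝ) • z - x ∈ Metric.ball c r := by
    rw [mem_ball_iff_norm] at hz ⊢
    have : (2 : ℝ) • z - x - c = (2 : ℝ) • (z - (2⁻¹ : ℝ) • (x + c)) := by module
    rw [this, norm_smul, Real.norm_ofNat]
    linarith
  have h := hf.le_coe hx (hM _ hy) (a := 2⁻¹) (b := 2⁻¹) (by norm_num) (by norm_num) (by norm_num)
  have hz' : (2⁻¹ : ℝ) • x + (2⁻¹ : ℝ) • ((2 : ℝ) • z - x) = z := by module
  rw [hz'] at h
  refine h.trans_eq ?_
  congr 1
  ring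

lemma inner_sub_le_fenchel (f : F → EReal) (x y : F) :
    (⟪x, y⟫_ℝ : EReal) - f x ≤ fenchel f y :=
  le_iSup (fun x => (⟪x, y⟫_ℝ : EReal) - f x) x

lemma fenchel_ne_bot {f : F → EReal} {x : F} (hx : f x ≠ ⊤) (y : F) : fenchel f y ≠ ⊥ := by
  intro h
  have := inner_sub_le_fenchel f x y
  rw [h, le_bot_iff] at this
  revert this hx
  induction f x <;> simp [← EReal.coe_sub]

lemma inner_le_add_fenchel {f : F → EReal} {x : F} (hx : f x ≠ ⊥) {x₀ : F} (hx₀ : f x₀ ≠ ⊤)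
    (y : F) : (⟪x, y⟫_ℝ : EReal) ≤ f x + fenchel f y := by
  have h := inner_sub_le_fenchel f x y
  have h' := fenchel_ne_bot hx₀ y
  rw [EReal.sub_le_iff_le_add (Or.inl hx) (Or.inr h')] at h
  rwa [add_comm]

lemma fenchel_fenchel_le {f : F → EReal} (hf : ∀ x, f x ≠ ⊥) {x₀ : F} (hx₀ : f x₀ ≠ ⊤) (x : F) :
    fenchel (fenchel f) x ≤ f x := by
  refine iSup_le fun y => EReal.sub_le_of_le_add ?_
  rw [real_inner_comm]
  exact inner_le_add_fenchel (hf x) hx₀ y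

lemma convexEReal_fenchel {f : F → EReal} (hf : ∀ x, f x ≠ ⊥) : ConvexEReal (fenchel f) := by
  intro x y a b ha hb hab
  refine iSup_le fun z => ?_
  rcases eq_or_ne (f z) ⊤ with hz | hz
  · simp [hz]
  have hx := inner_sub_le_fenchel f z x
  have hy := inner_sub_le_fenchel f z y
  lift f z to ℝ using ⟨hz, hf z⟩ with v
  refine le_trans (le_of_eq ?_) (add_le_add
    (mul_le_mul_of_nonneg_left hx (EReal.coe_nonneg.2 ha))
    (mul_le_mul_of_nonneg_left hy (EReal.coe_nonneg.2 hb)))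
  norm_cast
  rw [inner_add_right, inner_smul_right, inner_smul_right]
  linear_combination v * hab

lemma lowerSemicontinuous_fenchel (f : F → EReal) : LowerSemicontinuous (fenchel f) := by
  refine lowerSemicontinuous_iSup fun x => Continuous.lowerSemicontinuous ?_
  induction f x with
  | bot => simpa using continuous_const
  | top => simpa using continuous_const
  | coe r =>
    exact continuous_coe_real_ereal.comp
      ((continuous_const.inner continuous_id).sub continuous_const)

lemma IsProperConvexLSC.exists_affine_le [CompleteSpace F] {f : F → EReal}
    (hf : IsProperConvexLSC f) :
    ∃ (a : F) (b : ℝ), ∀ x, ((⟪a, x⟫_ℝ - b : ℝ) : EReal) ≤ f x := by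
  obtain ⟨hconv, hlsc, hbot, x₀, hx₀⟩ := hf
  obtain ⟨v, hv⟩ : ∃ v : ℝ, f x₀ = v := ⟨_, (EReal.coe_toReal hx₀ (hbot x₀)).symm⟩
  have hclosed : IsClosed {p : F × ℝ | f p.1 ≤ (p.2 : EReal)} :=
    hlsc.isClosed_epigraph.preimage
      (continuous_fst.prodMk (continuous_coe_real_ereal.comp continuous_snd))
  have hconvex : Convex ℝ {p : F × ℝ | f p.1 ≤ (p.2 : EReal)} := by
    intro p hp q hq a b ha hb hab
    exact hconv.le_coe hp hq ha hb hab
  have hnot : (x₀, v - 1) ∉ {p : F × ℝ | f p.1 ≤ (p.2 : EReal)} := by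
    simp only [mem_ofPred_eq, hv, EReal.coe_le_coe_iff]
    linarith
  obtain ⟨φ, u, hu, hφ⟩ := geometric_hahn_banach_point_closed hconvex hclosed hnot
  have hsplit (x : F) (t : ℝ) : φ (x, t) = φ (x, 0) + t * φ (0, 1) := by
    rw [← smul_eq_mul, ← map_smul, ← map_add]
    simp
  have hpos : 0 < φ (0, 1) := by
    have h := hφ (x₀, v) hv.le
    rw [hsplit] at h hu
    linarith
  set s := φ (0, 1)
  let ψ : F →L[ℝ] ℝ := φ.comp (ContinuousLinearMap.inl ℝ F ℝ)
  refine ⟨-(s⁻¹ • (InnerProductSpace.toDual ℝ F).symm ψ), -(s⁻¹ * u), fun x => ?_⟩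
  rcases eq_or_ne (f x) ⊤ with hx | hx
  · simp [hx]
  have h := hφ (x, (f x).toReal) (EReal.coe_toReal hx (hbot x)).ge
  rw [← EReal.coe_toReal hx (hbot x), EReal.coe_le_coe_iff, inner_neg_left, real_inner_smul_left,
    InnerProductSpace.toDual_symm_apply]
  rw [hsplit] at h
  have h2 : ψ x = φ (x, 0) := rfl
  rw [h2]
  have h3 : (f x).toReal = s⁻¹ * ((f x).toReal * s) := by field_simp
  rw [h3]
  have h4 : s⁻¹ * u ≤ s⁻¹ * (φ (x, 0) + (f x).toReal * s) :=
    mul_le_mul_of_nonneg_left h.le (inv_pos.2 hpos).le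
  linarith

lemma ConvexEReal.add_inner_le_of_hasGradientAt [CompleteSpace F] {f : F → EReal}
    (hf : ConvexEReal f) (hbot : ∀ x, f x ≠ ⊥) {x g : F} (hx : f x ≠ ⊤)
    (hg : HasGradientAt (fun y => (f y).toReal) g x) (y : F) :
    (((f x).toReal + ⟪g, y - x⟫_ℝ : ℝ) : EReal) ≤ f y := by
  rcases eq_or_ne (f y) ⊤ with hy | hy
  · simp [hy]
  have ex := EReal.coe_toReal hx (hbot x)
  have ey := EReal.coe_toReal hy (hbot y)
  rw [← ey, EReal.coe_le_coe_iff]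
  have hline : HasDerivAt (fun t : ℝ => (f (x + t • (y - x))).toReal) ⟪g, y - x⟫_ℝ 0 := by
    have h1 : HasFDerivAt (fun y => (f y).toReal) (InnerProductSpace.toDual ℝ F g)
        (x + (0 : ℝ) • (y - x)) := by
      simpa using hg.hasFDerivAt
    have h2 : HasDerivAt (fun t : ℝ => x + t • (y - x)) (y - x) 0 := by
      simpa using ((hasDerivAt_id (0 : ℝ)).smul_const (y - x)).const_add x
    have h3 := h1.comp_hasDerivAt (0 : ℝ) h2
    rwa [InnerProductSpace.toDual_apply_apply] at h3
  have hslope := hline.tendsto_slope_zero_right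
  have hle : ⟪g, y - x⟫_ℝ ≤ (f y).toReal - (f x).toReal := by
    refine le_of_tendsto hslope ?_
    filter_upwards [Ioc_mem_nhdsGT (zero_lt_one' ℝ)] with t ht
    have h := hf.le_coe ex.ge ey.ge (sub_nonneg.2 ht.2) ht.1.le (sub_add_cancel 1 t)
    have hpt : (1 - t) • x + t • y = x + t • (y - x) := by module
    rw [hpt] at h
    have h' : (f (x + t • (y - x))).toReal ≤ (1 - t) * (f x).toReal + t * (f y).toReal := by
      simpa only [EReal.toReal_coe] using
        EReal.toReal_le_toReal h (hbot _) (EReal.coe_ne_top _)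
    simp only [zero_add, zero_smul, add_zero, smul_eq_mul]
    rw [inv_mul_le_iff₀ ht.1]
    linarith
  linarith

end Convex

section LogConcave

open Metric

variable {F : Type*} [NormedAddCommGroup F] [InnerProductSpace ℝ F] [FiniteDimensional ℝ F]
  [MeasurableSpace F] [BorelSpace F] {μ : Measure F} [μ.IsAddHaarMeasure] {f : F → EReal}

lemma ConvexEReal.exists_ball_le (hf : ConvexEReal f) (hbot : ∀ x, f x ≠ ⊥)
    (hpos : 0 < ∫ x, expNeg (f x) ∂μ) :
    ∃ (c : F) (r M : ℝ), 0 < r ∧ ∀ x ∈ ball c r, f x ≤ M := by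
  by_contra! hcon
  have hnull (k : ℕ) : μ {x | f x ≤ ((k : ℝ) : EReal)} = 0 := by
    have hc := hf.convex_sublevel k
    refine measure_mono_null ?_ (hc.addHaar_frontier μ)
    refine fun x hx => ⟨subset_closure hx, fun hi => ?_⟩
    obtain ⟨r, hr, hsub⟩ := Metric.mem_nhds_iff.1 (mem_interior_iff_mem_nhds.1 hi)
    obtain ⟨y, hy, hlt⟩ := hcon x r k hr
    exact (hsub hy).not_gt hlt
  have hzero : (fun x => expNeg (f x)) =ᵐ[μ] 0 := by
    filter_upwards [ae_all_iff.2 fun k => measure_eq_zero_iff_ae_notMem.1 (hnull k)] with x hx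
    rcases eq_or_ne (f x) ⊤ with h | h
    · simp [h]
    · obtain ⟨k, hk⟩ := exists_nat_ge (f x).toReal
      refine absurd ?_ (hx k)
      rw [← EReal.coe_toReal h (hbot x)]
      exact_mod_cast hk
  rw [integral_congr_ae hzero] at hpos
  simp at hpos

lemma ConvexEReal.exp_mul_measureReal_ball_le (hf : ConvexEReal f) (hbot : ∀ x, f x ≠ ⊥)
    (hint : Integrable (fun x => expNeg (f x)) μ) {c x : F} {r M L : ℝ}
    (hM : ∀ y ∈ ball c r, f y ≤ M) (hx : f x ≤ L) {s : Set F}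
    (hsub : ball ((2⁻¹ : ℝ) • (x + c)) (r / 2) ⊆ s) :
    Real.exp (-((L + M) / 2)) * μ.real (ball (0 : F) (r / 2)) ≤ ∫ z in s, expNeg (f z) ∂μ := by
  have hball : μ.real (ball (0 : F) (r / 2)) = μ.real (ball ((2⁻¹ : ℝ) • (x + c)) (r / 2)) := by
    simp only [Measure.real, Measure.addHaar_ball_center]
  rw [hball]
  calc _ ≤ ∫ z in ball ((2⁻¹ : ℝ) • (x + c)) (r / 2), expNeg (f z) ∂μ := by
        refine setIntegral_ge_of_const_le_real measurableSet_ball measure_ball_lt_top.ne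
          (fun z hz => exp_le_expNeg (hbot z) (hf.le_half_of_mem_ball hM hx hz)) hint.integrableOn
    _ ≤ _ := setIntegral_mono_set hint.integrableOn
        (Filter.Eventually.of_forall fun z => expNeg_nonneg _) hsub.eventuallyLE

lemma ConvexEReal.exists_forall_coe_le (hf : ConvexEReal f) (hbot : ∀ x, f x ≠ ⊥)
    (hint : Integrable (fun x => expNeg (f x)) μ) {c : F} {r M : ℝ} (hr : 0 < r)
    (hM : ∀ y ∈ ball c r, f y ≤ M) : ∃ m : ℝ, ∀ x, (m : EReal) ≤ f x := by
  have hv : 0 < μ.real (ball (0 : F) (r / 2)) :=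
    ENNReal.toReal_pos (measure_ball_pos _ _ (by positivity)).ne' measure_ball_lt_top.ne
  refine ⟨-(M + 2 * Real.log ((∫ z, expNeg (f z) ∂μ) / μ.real (ball (0 : F) (r / 2)))),
    fun x => ?_⟩
  rcases eq_or_ne (f x) ⊤ with h | h
  · simp [h]
  have e := EReal.coe_toReal h (hbot x)
  have key := hf.exp_mul_measureReal_ball_le hbot hint hM e.ge (subset_univ _)
  rw [setIntegral_univ, ← le_div_iff₀ hv] at key
  have := (Real.le_log_iff_exp_le ((Real.exp_pos _).trans_le key)).2 key
  rw [← e, EReal.coe_le_coe_iff]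
  linarith

lemma ConvexEReal.exists_radius (hf : ConvexEReal f) (hbot : ∀ x, f x ≠ ⊥)
    (hint : Integrable (fun x => expNeg (f x)) μ) {c : F} {r M : ℝ} (hr : 0 < r)
    (hM : ∀ y ∈ ball c r, f y ≤ M) (L : ℝ) :
    ∃ R : ℝ, 0 < R ∧ ∀ x, f x ≤ L → ‖x - c‖ < R := by
  have hv : 0 < μ.real (ball (0 : F) (r / 2)) :=
    ENNReal.toReal_pos (measure_ball_pos _ _ (by positivity)).ne' measure_ball_lt_top.ne
  have htail : Filter.Tendsto (fun k : ℕ => ∫ z in (ball c k)ᶜ, expNeg (f z) ∂μ) Filter.atTop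
      (nhds (∫ z in ⋂ k : ℕ, (ball c k)ᶜ, expNeg (f z) ∂μ)) := by
    refine tendsto_setIntegral_of_antitone (fun k => measurableSet_ball.compl) ?_
      ⟨0, hint.integrableOn⟩
    exact fun i j hij => compl_subset_compl.2 (ball_subset_ball (by exact_mod_cast hij))
  rw [← compl_iUnion, iUnion_ball_nat, compl_univ, setIntegral_empty] at htail
  obtain ⟨k, hk⟩ := (htail.eventually_lt_const
    (show 0 < Real.exp (-((L + M) / 2)) * μ.real (ball (0 : F) (r / 2)) by positivity)).exists
  refine ⟨2 * k + r, by positivity, fun x hx => ?_⟩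
  by_contra! hcon
  refine (hf.exp_mul_measureReal_ball_le hbot hint hM hx ?_).not_gt hk
  intro z hz hz'
  rw [mem_ball_iff_norm] at hz hz'
  have h1 : x - c = (2 : ℝ) • (z - c) - (2 : ℝ) • (z - (2⁻¹ : ℝ) • (x + c)) := by module
  have h2 := norm_sub_le ((2 : ℝ) • (z - c)) ((2 : ℝ) • (z - (2⁻¹ : ℝ) • (x + c)))
  rw [← h1, norm_smul, norm_smul, Real.norm_ofNat] at h2
  linarith

lemma ConvexEReal.exists_norm_sub_le (hf : ConvexEReal f) (hbot : ∀ x, f x ≠ ⊥)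
    (hint : Integrable (fun x => expNeg (f x)) μ) {c : F} {r M : ℝ} (hr : 0 < r)
    (hM : ∀ y ∈ ball c r, f y ≤ M) :
    ∃ R : ℝ, 0 < R ∧ ∀ x, f x ≠ ⊤ → ‖x - c‖ ≤ R * (1 + |M| + |(f x).toReal|) := by
  obtain ⟨R, hR, hlevel⟩ := hf.exists_radius hbot hint hr hM (M + 1)
  refine ⟨R, hR, fun x hx => ?_⟩
  rcases lt_or_ge ‖x - c‖ R with h | h
  · have : 0 ≤ |M| + |(f x).toReal| := by positivity
    nlinarith
  have hpos : 0 < ‖x - c‖ := hR.trans_le h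
  set θ := R / ‖x - c‖
  have hθ : θ * ‖x - c‖ = R := div_mul_cancel₀ _ hpos.ne'
  have hθ0 : 0 ≤ θ := by positivity
  have hθ1 : θ ≤ 1 := (div_le_one hpos).2 h
  have hle := hf.le_coe (hM c (mem_ball_self hr)) (EReal.coe_toReal hx (hbot x)).ge
    (sub_nonneg.2 hθ1) hθ0 (sub_add_cancel 1 θ)
  have hlt : M + 1 < (1 - θ) * M + θ * (f x).toReal := by
    by_contra! hcon
    have := hlevel _ (hle.trans (EReal.coe_le_coe_iff.2 hcon))
    have h2 : (1 - θ) • c + θ • x - c = θ • (x - c) := by module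
    rw [h2, norm_smul, Real.norm_of_nonneg hθ0, hθ] at this
    exact this.false
  have h1 : 1 < θ * ((f x).toReal - M) := by linarith
  have h3 : ‖x - c‖ ≤ R * ((f x).toReal - M) := by
    rw [← hθ]
    nlinarith
  refine h3.trans (mul_le_mul_of_nonneg_left ?_ hR.le)
  linarith [le_abs_self (f x).toReal, neg_le_abs M]

lemma ConvexEReal.integrable_sqrt_expNeg (hf : ConvexEReal f) (hmeas : Measurable f)
    (hbot : ∀ x, f x ≠ ⊥) (hint : Integrable (fun x => expNeg (f x)) μ) {c : F} {M : ℝ}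
    (hM : f c ≤ M) : Integrable (fun x => √(expNeg (f x))) μ := by
  have h1 : Integrable (fun x => expNeg (f ((2⁻¹ : ℝ) • x + (2⁻¹ : ℝ) • c))) μ :=
    (hint.comp_add_right ((2⁻¹ : ℝ) • c)).comp_smul (by norm_num : (2⁻¹ : ℝ) ≠ 0)
  refine (h1.const_mul (Real.exp (M / 2))).mono'
    (measurable_expNeg.comp hmeas).sqrt.aestronglyMeasurable
    (Filter.Eventually.of_forall fun x => ?_)
  rw [Real.norm_of_nonneg (Real.sqrt_nonneg _)]
  rcases eq_or_ne (f x) ⊤ with h | h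
  · simp only [h, expNeg_top, Real.sqrt_zero]
    exact mul_nonneg (Real.exp_pos _).le (expNeg_nonneg _)
  have e := EReal.coe_toReal h (hbot x)
  have hle := hf.le_coe e.ge hM (a := 2⁻¹) (b := 2⁻¹) (by norm_num) (by norm_num) (by norm_num)
  have h2 := exp_le_expNeg (hbot _) hle
  calc √(expNeg (f x)) = Real.exp (-(f x).toReal / 2) := by
        rw [← e, expNeg_coe, EReal.toReal_coe, ← Real.exp_half]
    _ = Real.exp (M / 2) * Real.exp (-(2⁻¹ * (f x).toReal + 2⁻¹ * M)) := by
        rw [← Real.exp_add]; congr 1; ring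
    _ ≤ _ := mul_le_mul_of_nonneg_left h2 (Real.exp_pos _).le

lemma ConvexEReal.integrable_abs_mul_expNeg (hf : ConvexEReal f) (hmeas : Measurable f)
    (hbot : ∀ x, f x ≠ ⊥) (hint : Integrable (fun x => expNeg (f x)) μ) {c : F} {M m : ℝ}
    (hM : f c ≤ M) (hm : ∀ x, (m : EReal) ≤ f x) :
    Integrable (fun x => |(f x).toReal| * expNeg (f x)) μ := by
  refine ((hf.integrable_sqrt_expNeg hmeas hbot hint hM).const_mul
    (2 + |m| * Real.exp (|m| / 2))).mono'
    ((measurable_ereal_toReal.comp hmeas).abs.mul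
      (measurable_expNeg.comp hmeas)).aestronglyMeasurable
    (Filter.Eventually.of_forall fun x => ?_)
  rw [Real.norm_of_nonneg (mul_nonneg (abs_nonneg _) (expNeg_nonneg _))]
  have hmx := hm x
  rcases eq_or_ne (f x) ⊤ with h | h
  · simp [h]
  lift f x to ℝ using ⟨h, hbot x⟩ with v
  rw [EReal.coe_le_coe_iff] at hmx
  rw [expNeg_coe, EReal.toReal_coe, ← Real.exp_half]
  have h1 : Real.exp (-v) = Real.exp (-v / 2) * Real.exp (-v / 2) := by
    rw [← Real.exp_add]; congr 1; ring
  rw [h1, ← mul_assoc]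
  refine mul_le_mul_of_nonneg_right ?_ (Real.exp_pos _).le
  have h0 : 0 ≤ |m| * Real.exp (|m| / 2) := by positivity
  rcases le_total 0 v with hv | hv
  · have h2 : v * Real.exp (-v / 2) ≤ 2 := by
      have h3 := Real.add_one_le_exp (v / 2)
      have h4 : Real.exp (v / 2) * Real.exp (-v / 2) = 1 := by
        rw [← Real.exp_add, ← add_div]; simp
      have h5 := Real.exp_pos (-v / 2)
      nlinarith
    rw [abs_of_nonneg hv]
    linarith
  · have h2 : |v| ≤ |m| := abs_le_abs_of_nonpos hv hmx
    have h3 : -v ≤ |m| := by rwa [← abs_of_nonpos hv]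
    have h4 : |v| * Real.exp (-v / 2) ≤ |m| * Real.exp (|m| / 2) := by gcongr
    linarith

lemma ConvexEReal.integrable_norm_sub_mul_expNeg (hf : ConvexEReal f) (hmeas : Measurable f)
    (hbot : ∀ x, f x ≠ ⊥) (hint : Integrable (fun x => expNeg (f x)) μ) {c : F} {r M m : ℝ}
    (hr : 0 < r) (hM : ∀ y ∈ ball c r, f y ≤ M) (hm : ∀ x, (m : EReal) ≤ f x) :
    Integrable (fun x => ‖x - c‖ * expNeg (f x)) μ := by
  obtain ⟨R, hR, hle⟩ := hf.exists_norm_sub_le hbot hint hr hM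
  have hv := hf.integrable_abs_mul_expNeg hmeas hbot hint (hM c (mem_ball_self hr)) hm
  refine (((hint.const_mul (1 + |M|)).add hv).const_mul R).mono'
    ((measurable_id.sub_const c).norm.mul (measurable_expNeg.comp hmeas)).aestronglyMeasurable
    (Filter.Eventually.of_forall fun x => ?_)
  rw [Real.norm_of_nonneg (mul_nonneg (norm_nonneg _) (expNeg_nonneg _))]
  rcases eq_or_ne (f x) ⊤ with h | h
  · simp [h]
  have := mul_le_mul_of_nonneg_right (hle x h) (expNeg_nonneg (f x))
  simp only [Pi.add_apply]
  linarith

end LogConcave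

section Gradient

open Metric

variable {F : Type*} [NormedAddCommGroup F] [InnerProductSpace ℝ F]

lemma ConvexEReal.expNeg_dilation_le [CompleteSpace F] {f : F → EReal} (hf : ConvexEReal f)
    (hbot : ∀ x, f x ≠ ⊥) {x g : F} (hx : f x ≠ ⊤)
    (hg : HasGradientAt (fun y => (f y).toReal) g x) (c : F) (s : ℝ) :
    expNeg (f (x + s • (x - c))) ≤ expNeg (f x) * Real.exp (-(s * ⟪g, x - c⟫_ℝ)) := by
  have h := expNeg_le_exp (hf.add_inner_le_of_hasGradientAt hbot hx hg (x + s • (x - c)))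
  rw [add_sub_cancel_left, inner_smul_right, neg_add, Real.exp_add] at h
  rwa [← EReal.coe_toReal hx (hbot x), expNeg_coe]

lemma ConvexEReal.eq_top_dilation {f : F → EReal} (hf : ConvexEReal f)
    (hbot : ∀ x, f x ≠ ⊥) {x c : F} {M s : ℝ} (hs : 0 < s) (hM : f c ≤ M) (hx : f x = ⊤) :
    f (x + s • (x - c)) = ⊤ := by
  by_contra h
  have hle := hf.le_coe (EReal.coe_toReal h (hbot _)).ge hM (a := (1 + s)⁻¹)
    (b := (1 + s)⁻¹ * s) (by positivity) (by positivity) (by field_simp)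
  have hpt : (1 + s)⁻¹ • (x + s • (x - c)) + ((1 + s)⁻¹ * s) • c = x := by
    have : (1 + s)⁻¹ • (x + s • (x - c)) + ((1 + s)⁻¹ * s) • c = ((1 + s)⁻¹ * (1 + s)) • x := by
      module
    rw [this, inv_mul_cancel₀ (by positivity), one_smul]
  rw [hpt, hx] at hle
  exact EReal.coe_ne_top _ (top_le_iff.1 hle)

lemma neg_mul_exp_le_one_sub_exp_div {p K s : ℝ} (hK : 0 ≤ K) (hp : -K ≤ p) (hs : 0 < s)
    (hs1 : s ≤ 1) : -(K * Real.exp K) ≤ (1 - Real.exp (-(s * p))) / s := by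
  rw [le_div_iff₀ hs]
  have h1 : Real.exp (-(s * p)) ≤ Real.exp (s * K) := Real.exp_le_exp.2 (by nlinarith)
  have h2 : Real.exp (s * K) - 1 ≤ s * K * Real.exp (s * K) := by
    have h3 := Real.add_one_le_exp (-(s * K))
    have h4 : Real.exp (s * K) * Real.exp (-(s * K)) = 1 := by rw [← Real.exp_add]; simp
    nlinarith [Real.exp_pos (s * K)]
  have h3 : Real.exp (s * K) ≤ Real.exp K := Real.exp_le_exp.2 (by nlinarith)
  have h4 : s * K * Real.exp (s * K) ≤ s * K * Real.exp K := by gcongr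
  linarith

lemma tendsto_one_sub_exp_div (p : ℝ) :
    Filter.Tendsto (fun k : ℕ => (1 - Real.exp (-(1 / ((k : ℝ) + 1) * p))) / (1 / ((k : ℝ) + 1)))
      Filter.atTop (nhds p) := by
  have hd : HasDerivAt (fun s : ℝ => -Real.exp (-(s * p))) p 0 := by
    have h : HasDerivAt (fun s : ℝ => -Real.exp (-(s * p))) (-(Real.exp (-(0 * p)) * -(1 * p))) 0 :=
      (((hasDerivAt_id (0 : ℝ)).mul_const p).neg.exp).neg
    simpa using h
  have h1 := hd.tendsto_slope_zero_right
  have h2 : Filter.Tendsto (fun k : ℕ => 1 / ((k : ℝ) + 1)) Filter.atTop (nhdsWithin 0 (Ioi 0)) :=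
    tendsto_nhdsWithin_iff.2 ⟨tendsto_one_div_add_atTop_nhds_zero_nat,
      Filter.Eventually.of_forall fun k => by simp only [mem_Ioi]; positivity⟩
  refine (h1.comp h2).congr fun k => ?_
  simp only [Function.comp_apply, zero_add, zero_mul, neg_zero, Real.exp_zero, smul_eq_mul]
  rw [inv_mul_eq_div]
  congr 1
  ring

lemma one_sub_inv_one_add_pow_div_le (n : ℕ) {s : ℝ} (hs : 0 < s) :
    (1 - ((1 + s) ^ n)⁻¹) / s ≤ n := by
  rw [div_le_iff₀ hs]
  have h1 : -(s / (1 + s)) ≥ -s := by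
    have : s / (1 + s) ≤ s := div_le_self hs.le (by linarith)
    linarith
  have h2 : s / (1 + s) ≤ 1 := (div_le_one (by positivity)).2 (by linarith)
  have h3 := one_add_mul_le_pow (a := -(s / (1 + s))) (by linarith) n
  have h4 : 1 + -(s / (1 + s)) = (1 + s)⁻¹ := by field_simp; ring
  rw [h4, inv_pow] at h3
  have h5 : (n : ℝ) * -s ≤ n * -(s / (1 + s)) := by gcongr
  linarith

variable [FiniteDimensional ℝ F] [MeasurableSpace F] [BorelSpace F] {μ : Measure F}
  [μ.IsAddHaarMeasure] {f : F → EReal}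

lemma integrable_comp_dilation {w : F → ℝ} (hw : Integrable w μ) (c : F) {s : ℝ} (hs : 0 < s) :
    Integrable (fun x => w (x + s • (x - c))) μ := by
  have h := (hw.comp_sub_right (s • c)).comp_smul (by positivity : (1 + s) ≠ 0)
  refine h.congr (Filter.Eventually.of_forall fun x => ?_)
  change w ((1 + s) • x - s • c) = w (x + s • (x - c))
  congr 1
  module

lemma integral_comp_dilation (w : F → ℝ) (c : F) {s : ℝ} (hs : 0 < s) :
    ∫ x, w (x + s • (x - c)) ∂μ = ((1 + s) ^ Module.finrank ℝ F)⁻¹ * ∫ x, w x ∂μ := by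
  have h := Measure.integral_comp_smul_of_nonneg μ (fun x => w (x - s • c)) (1 + s)
    (hR := by positivity)
  rw [integral_sub_right_eq_self, smul_eq_mul] at h
  rw [← h]
  congr 1 with x
  congr 1
  module

lemma ConvexEReal.integrable_inner_mul_expNeg (hf : ConvexEReal f) (hbot : ∀ x, f x ≠ ⊥)
    (hint : Integrable (fun x => expNeg (f x)) μ) {c : F} {M m : ℝ}
    (hM : f c ≤ M) (hm : ∀ x, (m : EReal) ≤ f x) {g : F → F} (hgm : Measurable g)
    (hfm : Measurable f)
    (hg : ∀ᵐ x ∂μ, f x ≠ ⊤ → HasGradientAt (fun y => (f y).toReal) (g x) x) :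
    Integrable (fun x => ⟪g x, x - c⟫_ℝ * expNeg (f x)) μ := by
  set p : F → ℝ := fun x => ⟪g x, x - c⟫_ℝ
  set w : F → ℝ := fun x => expNeg (f x)
  have hpm : Measurable p := hgm.inner (measurable_id.sub_const c)
  have hwm : Measurable w := measurable_expNeg.comp hfm
  set K₀ := |M - m|
  set K := K₀ * Real.exp K₀
  have hK₀ : 0 ≤ K₀ := abs_nonneg _
  have hKK : K₀ ≤ K := le_mul_of_one_le_right hK₀ (Real.one_le_exp hK₀)
  have hp : ∀ᵐ x ∂μ, f x ≠ ⊤ → -K₀ ≤ p x := by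
    filter_upwards [hg] with x hx h
    have h1 := (hf.add_inner_le_of_hasGradientAt hbot h (hx h) c).trans hM
    have h2 := hm x
    rw [← EReal.coe_toReal h (hbot x), EReal.coe_le_coe_iff] at h2
    rw [EReal.coe_le_coe_iff, ← neg_sub x c, inner_neg_right] at h1
    linarith [le_abs_self (M - m)]
  let s : ℕ → ℝ := fun k => 1 / ((k : ℝ) + 1)
  have hs (k) : 0 < s k := by positivity
  have hs1 (k) : s k ≤ 1 := by
    simp only [s]
    rw [div_le_one (by positivity)]
    linarith [Nat.cast_nonneg (α := ℝ) k]
  let q : ℕ → F → ℝ := fun k x => (1 - Real.exp (-(s k * p x))) / s k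
  let φ : ℕ → F → ℝ := fun k x => (w x - w (x + s k • (x - c))) / s k + K * w x
  have hqφ (k : ℕ) : ∀ᵐ x ∂μ, 0 ≤ q k x * w x + K * w x ∧ q k x * w x + K * w x ≤ φ k x := by
    filter_upwards [hg, hp] with x hx hpx
    by_cases h : f x = ⊤
    · have h0 : w x = 0 := by simp [w, h]
      have h1 : w (x + s k • (x - c)) = 0 := by
        simp [w, hf.eq_top_dilation hbot (hs k) hM h]
      simp [φ, h0, h1]
    · have hw0 : 0 ≤ w x := expNeg_nonneg _
      have h1 := neg_mul_exp_le_one_sub_exp_div hK₀ (hpx h) (hs k) (hs1 k)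
      have h2 := hf.expNeg_dilation_le hbot h (hx h) c (s k)
      refine ⟨?_, ?_⟩
      · rw [← add_mul]
        refine mul_nonneg ?_ hw0
        change -K ≤ q k x at h1
        linarith
      · refine add_le_add_left ?_ _
        simp only [q]
        rw [div_mul_eq_mul_div]
        refine div_le_div_of_nonneg_right ?_ (hs k).le
        change w (x + s k • (x - c)) ≤ w x * Real.exp (-(s k * p x)) at h2
        linarith
  have hbound (k : ℕ) : ∫⁻ x, ENNReal.ofReal (q k x * w x + K * w x) ∂μ ≤
      ENNReal.ofReal ((Module.finrank ℝ F + K) * ∫ x, w x ∂μ) := by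
    have hdil := integrable_comp_dilation hint c (hs k)
    have hdiff : Integrable (fun x => (w x - w (x + s k • (x - c))) / s k) μ :=
      (hint.sub hdil).div_const _
    have hφint : Integrable (φ k) μ := hdiff.add (hint.const_mul K)
    calc _ ≤ ∫⁻ x, ENNReal.ofReal (φ k x) ∂μ :=
          lintegral_mono_ae ((hqφ k).mono fun x hx => ENNReal.ofReal_le_ofReal hx.2)
      _ = ENNReal.ofReal (∫ x, φ k x ∂μ) := (ofReal_integral_eq_lintegral_ofReal hφint
          ((hqφ k).mono fun x hx => hx.1.trans hx.2)).symm
      _ ≤ _ := by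
        refine ENNReal.ofReal_le_ofReal ?_
        have h1 : ∫ x, φ k x ∂μ =
            (1 - ((1 + s k) ^ Module.finrank ℝ F)⁻¹) / s k * ∫ x, w x ∂μ + K * ∫ x, w x ∂μ := by
          simp only [φ]
          rw [integral_add hdiff (hint.const_mul K), integral_div, integral_sub hint hdil,
            integral_comp_dilation w c (hs k), integral_const_mul]
          ring
        rw [h1, ← add_mul]
        refine mul_le_mul_of_nonneg_right ?_ (integral_nonneg fun x => expNeg_nonneg _)
        linarith [one_sub_inv_one_add_pow_div_le (Module.finrank ℝ F) (hs k)]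
  have hlim (x : F) : Filter.liminf (fun k => ENNReal.ofReal (q k x * w x + K * w x)) Filter.atTop
      = ENNReal.ofReal (p x * w x + K * w x) :=
    (ENNReal.tendsto_ofReal
      (((tendsto_one_sub_exp_div (p x)).mul_const (w x)).add_const (K * w x))).liminf_eq
  have hfatou : ∫⁻ x, ENNReal.ofReal (p x * w x + K * w x) ∂μ ≠ ⊤ := by
    refine ne_top_of_le_ne_top ENNReal.ofReal_ne_top
      (b := ENNReal.ofReal ((Module.finrank ℝ F + K) * ∫ x, w x ∂μ)) ?_
    calc _ = ∫⁻ x, Filter.liminf (fun k => ENNReal.ofReal (q k x * w x + K * w x))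
            Filter.atTop ∂μ := by simp only [hlim]
      _ ≤ Filter.liminf (fun k => ∫⁻ x, ENNReal.ofReal (q k x * w x + K * w x) ∂μ)
            Filter.atTop := by
          refine lintegral_liminf_le fun k => ?_
          simp only [q]
          fun_prop
      _ ≤ _ := Filter.liminf_le_of_frequently_le' (Filter.Frequently.of_forall hbound)
  rw [lintegral_ofReal_ne_top_iff_integrable (by fun_prop)] at hfatou
  · exact (hfatou.sub (hint.const_mul K)).congr
      (Filter.Eventually.of_forall fun x => add_sub_cancel_right _ _)
  · filter_upwards [hp] with x hx
    by_cases h : f x = ⊤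
    · simp [w, h]
    · have hw0 : 0 ≤ w x := expNeg_nonneg _
      simp only [Pi.zero_apply]
      rw [← add_mul]
      exact mul_nonneg (by linarith [hx h]) hw0

lemma ConvexEReal.integrable_norm_gradient_mul_expNeg (hf : ConvexEReal f)
    (hbot : ∀ x, f x ≠ ⊥) (hint : Integrable (fun x => expNeg (f x)) μ) {c : F} {r M m : ℝ}
    (hr : 0 < r) (hM : ∀ y ∈ ball c r, f y ≤ M) (hm : ∀ x, (m : EReal) ≤ f x)
    {g : F → F} (hgm : Measurable g) (hfm : Measurable f)
    (hg : ∀ᵐ x ∂μ, f x ≠ ⊤ → HasGradientAt (fun y => (f y).toReal) (g x) x) :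
    Integrable (fun x => ‖g x‖ * expNeg (f x)) μ := by
  have hMc := hM c (mem_ball_self hr)
  have h1 := hf.integrable_inner_mul_expNeg hbot hint hMc hm hgm hfm hg
  have h2 := hf.integrable_abs_mul_expNeg hfm hbot hint hMc hm
  refine ((((hint.const_mul M).add h2).add h1).const_mul (2 / r)).mono'
    (hgm.norm.mul (measurable_expNeg.comp hfm)).aestronglyMeasurable ?_
  filter_upwards [hg] with x hx
  rw [Real.norm_of_nonneg (mul_nonneg (norm_nonneg _) (expNeg_nonneg _))]
  by_cases h : f x = ⊤
  · simp [h]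
  have hmem : c + (r / 2) • (‖g x‖⁻¹ • g x) ∈ ball c r := by
    rw [mem_ball_iff_norm, add_sub_cancel_left, norm_smul, Real.norm_of_nonneg (by positivity),
      norm_smul, norm_inv, norm_norm]
    have : ‖g x‖⁻¹ * ‖g x‖ ≤ 1 := inv_mul_le_one
    nlinarith
  have hsub := (hf.add_inner_le_of_hasGradientAt hbot h (hx h) _).trans (hM _ hmem)
  have hinner : ⟪g x, c + (r / 2) • (‖g x‖⁻¹ • g x) - x⟫_ℝ =
      r / 2 * ‖g x‖ - ⟪g x, x - c⟫_ℝ := by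
    have h3 : c + (r / 2) • (‖g x‖⁻¹ • g x) - x = (r / 2) • (‖g x‖⁻¹ • g x) - (x - c) := by abel
    rw [h3, inner_sub_right, inner_smul_right, inner_smul_right, real_inner_self_eq_norm_sq]
    rcases eq_or_ne ‖g x‖ 0 with h0 | h0
    · simp [h0]
    · field_simp
  rw [hinner, EReal.coe_le_coe_iff] at hsub
  have h4 : ‖g x‖ ≤ 2 / r * (M + |(f x).toReal| + ⟪g x, x - c⟫_ℝ) := by
    rw [div_mul_eq_mul_div, le_div_iff₀ hr]
    linarith [neg_abs_le (f x).toReal]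
  have := mul_le_mul_of_nonneg_right h4 (expNeg_nonneg (f x))
  simp only [Pi.add_apply]
  linarith

end Gradient

section GibbsMeasure

variable {α : Type*} [MeasurableSpace α] {μ : Measure α}

lemma lintegral_ERealPos_neg_ne_top {g : α → EReal} {φ : α → ℝ} (hφ : Integrable φ μ)
    (h : ∀ x, (φ x : EReal) ≤ g x) : ∫⁻ x, ERealPos (-(g x)) ∂μ ≠ ⊤ := by
  refine ne_top_of_le_ne_top hφ.neg.lintegral_lt_top.ne (lintegral_mono fun x => ?_)
  exact ERealPos_mono (EReal.neg_le_neg_iff.2 (h x))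

variable {w : α → ℝ} {Z : ℝ}

lemma integrable_withDensity_div_of_integrable_mul (hwm : Measurable w) (hw : ∀ x, 0 ≤ w x)
    (hZ : 0 < Z) {φ : α → ℝ} (hφ : Integrable (fun x => φ x * w x) μ) :
    Integrable φ (μ.withDensity fun x => ENNReal.ofReal (w x / Z)) := by
  rw [integrable_withDensity_iff_integrable_smul' (by fun_prop)
    (Filter.Eventually.of_forall fun x => ENNReal.ofReal_lt_top)]
  refine (hφ.div_const Z).congr (Filter.Eventually.of_forall fun x => ?_)
  simp only [ENNReal.toReal_ofReal (div_nonneg (hw x) hZ.le), smul_eq_mul]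
  ring

lemma isProbabilityMeasure_withDensity_div (hw : ∀ x, 0 ≤ w x) (hint : Integrable w μ)
    (hZ : Z = ∫ x, w x ∂μ) (hZpos : 0 < Z) :
    IsProbabilityMeasure (μ.withDensity fun x => ENNReal.ofReal (w x / Z)) := by
  constructor
  rw [withDensity_apply _ MeasurableSet.univ, setLIntegral_univ,
    ← ofReal_integral_eq_lintegral_ofReal (hint.div_const Z)
      (Filter.Eventually.of_forall fun x => div_nonneg (hw x) hZpos.le),
    integral_div, ← hZ, div_self hZpos.ne', ENNReal.ofReal_one]

end GibbsMeasure

section Duality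

variable {F : Type*} [NormedAddCommGroup F] [InnerProductSpace ℝ F]

lemma ConvexEReal.fenchel_gradient [CompleteSpace F] {f : F → EReal} (hf : ConvexEReal f)
    (hbot : ∀ x, f x ≠ ⊥) {x g : F} (hx : f x ≠ ⊤)
    (hg : HasGradientAt (fun y => (f y).toReal) g x) :
    fenchel f g = ((⟪x, g⟫_ℝ - (f x).toReal : ℝ) : EReal) := by
  refine le_antisymm (iSup_le fun y => ?_) ?_
  · have h := hf.add_inner_le_of_hasGradientAt hbot hx hg y
    refine (EReal.sub_le_sub le_rfl h).trans_eq ?_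
    norm_cast
    rw [inner_sub_right, real_inner_comm g y, real_inner_comm g x]
    ring
  · refine le_trans (le_of_eq ?_) (inner_sub_le_fenchel f x g)
    rw [EReal.coe_sub, EReal.coe_toReal hx (hbot x)]

lemma ConvexEReal.fenchel_fenchel_eq [CompleteSpace F] {f : F → EReal} (hf : ConvexEReal f)
    (hbot : ∀ x, f x ≠ ⊥) {x g : F} (hx : f x ≠ ⊤)
    (hg : HasGradientAt (fun y => (f y).toReal) g x) : fenchel (fenchel f) x = f x := by
  refine le_antisymm (fenchel_fenchel_le hbot hx x) ?_
  refine le_trans (le_of_eq ?_) (inner_sub_le_fenchel (fenchel f) g x)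
  rw [hf.fenchel_gradient hbot hx hg, ← EReal.coe_sub, real_inner_comm, sub_sub_cancel,
    EReal.coe_toReal hx (hbot x)]

lemma inner_sub_toReal_le_fenchel {f : F → EReal} {x : F} (hx : f x ≠ ⊤) (hx' : f x ≠ ⊥) (y : F) :
    ((⟪x, y⟫_ℝ - (f x).toReal : ℝ) : EReal) ≤ fenchel f y := by
  rw [EReal.coe_sub, EReal.coe_toReal hx hx']
  exact inner_sub_le_fenchel f x y

variable [CompleteSpace F] [MeasurableSpace F] [BorelSpace F] {η : Measure F} [IsFiniteMeasure η]
  {T : F → F}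

lemma IsProperConvexLSC.eintegral_map_add_fenchel {f : F → EReal} (hf : IsProperConvexLSC f)
    (hT : Measurable T) (hTint : Integrable T η) (hid : Integrable (fun x => x) η) :
    eintegral (η.map T) f + eintegral η (fenchel f) =
      eintegral η (fun x => f (T x) + fenchel f x) := by
  have hfm : Measurable f := hf.2.1.measurable
  obtain ⟨a, b, hab⟩ := hf.exists_affine_le
  obtain ⟨-, -, hbot, x₀, hx₀⟩ := hf
  rw [eintegral_map hT hfm]
  refine (eintegral_add (hfm.comp hT) (lowerSemicontinuous_fenchel f).measurable ?_ ?_).symm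
  · exact lintegral_ERealPos_neg_ne_top ((hTint.const_inner a).sub (integrable_const b))
      fun x => hab (T x)
  · exact lintegral_ERealPos_neg_ne_top
      ((hid.const_inner x₀).sub (integrable_const (f x₀).toReal))
      fun x => inner_sub_toReal_le_fenchel hx₀ (hbot x₀) x

lemma mcCost_map_eq {V : F → EReal} (hV : ConvexEReal V) (hbot : ∀ x, V x ≠ ⊥) [NeZero η]
    (hVtop : ∀ᵐ x ∂η, V x ≠ ⊤) (hT : Measurable T) (hTint : Integrable T η)
    (hid : Integrable (fun x => x) η)
    (hgrad : ∀ᵐ x ∂η, HasGradientAt (fun y => (V y).toReal) (T x) x) :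
    mcCost (η.map T) η = eintegral (η.map T) (fenchel V) + eintegral η V ∧
      mcCost (η.map T) η = eintegral η (fun x => ((⟪x, T x⟫_ℝ : ℝ) : EReal)) := by
  obtain ⟨x₀, hx₀, hg₀⟩ := (hVtop.and hgrad).exists
  have hproper : IsProperConvexLSC (fenchel V) :=
    ⟨convexEReal_fenchel hbot, lowerSemicontinuous_fenchel V, fenchel_ne_bot hx₀, T x₀, by
      rw [hV.fenchel_gradient hbot hx₀ hg₀]; exact EReal.coe_ne_top _⟩
  have hdual : eintegral η (fenchel (fenchel V)) = eintegral η V := by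
    refine eintegral_congr_ae ?_
    filter_upwards [hVtop, hgrad] with x hx hg
    exact hV.fenchel_fenchel_eq hbot hx hg
  have hopt : eintegral (η.map T) (fenchel V) + eintegral η V =
      eintegral η (fun x => ((⟪x, T x⟫_ℝ : ℝ) : EReal)) := by
    rw [← hdual, hproper.eintegral_map_add_fenchel hT hTint hid]
    refine eintegral_congr_ae ?_
    filter_upwards [hVtop, hgrad] with x hx hg
    rw [hV.fenchel_fenchel_eq hbot hx hg, hV.fenchel_gradient hbot hx hg, EReal.coe_sub]
    exact (congrArg _ (EReal.coe_toReal hx (hbot x)).symm).trans EReal.sub_add_cancel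
  have hcost : mcCost (η.map T) η = eintegral η (fun x => ((⟪x, T x⟫_ℝ : ℝ) : EReal)) := by
    refine le_antisymm ?_ (le_iInf fun ⟨f, hf⟩ => ?_)
    · rw [← hopt, ← hdual]
      exact iInf_le (fun f : {f : F → EReal // IsProperConvexLSC f} =>
        eintegral (η.map T) f.1 + eintegral η (fenchel f.1)) ⟨fenchel V, hproper⟩
    · rw [hf.eintegral_map_add_fenchel hT hTint hid]
      obtain ⟨-, -, hfbot, y₀, hy₀⟩ := hf
      refine eintegral_mono_ae (Filter.Eventually.of_forall fun x => ?_)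
      rw [real_inner_comm]
      exact inner_le_add_fenchel (hfbot (T x)) hy₀ x
  exact ⟨hcost.trans hopt.symm, hcost⟩

end Duality

/-- equation (2.2). Let `V : ℝⁿ → ℝ ∪ {+∞}` be convex lower
semicontinuous with `Z := ∫ e^{-V} dx ∈ (0,∞)`, let `η = Z⁻¹ e^{-V} dx` and let
`ν = ∇V # η` be its moment measure. Then
`𝒯(ν,η) = ∫ V* dν + ∫ V dη = ∫ x·∇V(x) dη(x)`. -/
theorem statement1 {n : ℕ} (V : EuclideanSpace ℝ (Fin n) → EReal)
    (hVconv : ConvexEReal V) (hVlsc : LowerSemicontinuous V) (hVbot : ∀ x, V x ≠ ⊥)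
    (hVint : Integrable (fun x => expNeg (V x)) volume)
    (Z : ℝ) (hZ : Z = ∫ x, expNeg (V x)) (hZpos : 0 < Z)
    (η : Measure (EuclideanSpace ℝ (Fin n)))
    (hη : η = volume.withDensity (fun x => ENNReal.ofReal (expNeg (V x) / Z)))
    (gV : EuclideanSpace ℝ (Fin n) → EuclideanSpace ℝ (Fin n)) (hgVmeas : Measurable gV)
    (hgrad : ∀ᵐ x ∂η, HasGradientAt (fun y => (V y).toReal) (gV x) x)
    (ν : Measure (EuclideanSpace ℝ (Fin n))) (hν : ν = Measure.map gV η) :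
    mcCost ν η = eintegral ν (fenchel V) + eintegral η V ∧
      mcCost ν η = eintegral η (fun x => ((⟪x, gV x⟫_ℝ : ℝ) : EReal)) := by
  have hVm : Measurable V := hVlsc.measurable
  have hwm : Measurable fun x => expNeg (V x) := measurable_expNeg.comp hVm
  have hw0 (x) : 0 ≤ expNeg (V x) := expNeg_nonneg _
  have hprob : IsProbabilityMeasure η :=
    hη ▸ isProbabilityMeasure_withDensity_div hw0 hVint hZ hZpos
  have hVtop : ∀ᵐ x ∂η, V x ≠ ⊤ := by
    rw [hη, ae_withDensity_iff (by fun_prop)]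
    refine Filter.Eventually.of_forall fun x hx h => hx ?_
    simp [h]
  have hgrad' : ∀ᵐ x, V x ≠ ⊤ → HasGradientAt (fun y => (V y).toReal) (gV x) x := by
    rw [hη, ae_withDensity_iff (by fun_prop)] at hgrad
    filter_upwards [hgrad] with x hx h
    refine hx (ENNReal.ofReal_pos.2 (div_pos ?_ hZpos)).ne'
    rw [← EReal.coe_toReal h (hVbot x), expNeg_coe]
    positivity
  obtain ⟨c, r, M, hr, hM⟩ := hVconv.exists_ball_le hVbot (hZ ▸ hZpos)
  obtain ⟨m, hm⟩ := hVconv.exists_forall_coe_le hVbot hVint hr hM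
  have hid : Integrable (fun x => x) η := by
    have h : Integrable (fun x => ‖x - c‖) η := hη ▸
      integrable_withDensity_div_of_integrable_mul hwm hw0 hZpos
        (hVconv.integrable_norm_sub_mul_expNeg hVm hVbot hVint hr hM hm)
    rw [integrable_norm_iff (by fun_prop)] at h
    exact (h.add (integrable_const c)).congr
      (Filter.Eventually.of_forall fun x => sub_add_cancel x c)
  have hgint : Integrable gV η := by
    have h : Integrable (fun x => ‖gV x‖) η := hη ▸
      integrable_withDensity_div_of_integrable_mul hwm hw0 hZpos
        (hVconv.integrable_norm_gradient_mul_expNeg hVbot hVint hr hM hm hgVmeas hVm hgrad')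
    rwa [integrable_norm_iff (by fun_prop)] at h
  rw [hν]
  exact mcCost_map_eq hVconv hVbot hVtop hgVmeas hgint hid hgrad

end
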